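/- arXiv:1304.1849 — 4 statements merged into one kernel-verified Lean document; each statement's English description precedes it below -/
import Mathlib

section
/- Let ν be a (nonnegative, σ-finite) measure on ℝ satisfying ∫_ℝ min(1, z²) ν(dz) < ∞ and ∫_{|z|≥1} |z| ν(dz) < ∞. Then for every Schwartz function f : ℝ → ℂ, the function g(x) := ∫_ℝ ( f(x−z) − f(x) ) z ν(dz) is well defined and Lebesgue integrable on ℝ, and its Fourier transform ℱg(ξ) := ∫_ℝ e^{ixξ} g(x) dx satisfies ℱg(ξ) = ( ∫_ℝ (e^{izξ} − 1) z ν(dz) ) · ℱf(ξ) for every ξ ∈ ℝ. -/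
open Real MeasureTheory

/-- A Schwartz function on the line is bounded by a multiple of the Cauchy density. -/
lemma SchwartzMap.exists_norm_le_inv_one_add_sq (f : SchwartzMap ℝ ℂ) :
    ∃ C, 0 < C ∧ ∀ x, ‖f x‖ ≤ C * (1 + x ^ 2)⁻¹ := by
  obtain ⟨C₀, h₀, hC₀⟩ := f.decay 0 0
  obtain ⟨C₂, h₂, hC₂⟩ := f.decay 2 0
  refine ⟨C₀ + C₂, by positivity, fun x => ?_⟩
  have a := hC₀ x
  have b := hC₂ x
  simp only [norm_iteratedFDeriv_zero, pow_zero, one_mul, Real.norm_eq_abs, sq_abs] at a b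
  rw [← div_eq_mul_inv, le_div_iff₀ (by positivity)]
  nlinarith

/-- Short translates of a Schwartz function differ from it by at most the length of the
translation times a multiple of the Cauchy density. -/
lemma SchwartzMap.exists_norm_sub_le_abs_mul (f : SchwartzMap ℝ ℂ) :
    ∃ C, 0 < C ∧ ∀ x z : ℝ, |z| ≤ 1 → ‖f (x - z) - f x‖ ≤ C * |z| * (1 + x ^ 2)⁻¹ := by
  obtain ⟨C, hC, hb⟩ := (SchwartzMap.derivCLM ℝ ℂ f).exists_norm_le_inv_one_add_sq
  refine ⟨3 * C, by positivity, fun x z hz => ?_⟩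
  have key := Convex.norm_image_sub_le_of_norm_deriv_le (f := f) (s := Metric.closedBall x 1)
    (C := 3 * C * (1 + x ^ 2)⁻¹) (x := x) (y := x - z) (𝕜 := ℝ)
    (fun w _ => f.differentiable w) (fun w hw => ?_) (convex_closedBall x 1)
    (Metric.mem_closedBall_self zero_le_one) (by simpa [Real.dist_eq] using hz)
  · refine key.trans_eq ?_
    simp only [sub_sub_cancel_left, norm_neg, Real.norm_eq_abs]
    ring
  · have := hb w
    rw [SchwartzMap.derivCLM_apply] at this
    refine this.trans ?_
    rw [Metric.mem_closedBall, Real.dist_eq, abs_le] at hw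
    rw [← div_eq_mul_inv, ← div_eq_mul_inv, div_le_div_iff₀ (by positivity) (by positivity)]
    have : 1 + x ^ 2 ≤ 3 * (1 + w ^ 2) := by nlinarith [sq_nonneg (2 * w - x)]
    nlinarith

/-- The weight `z ↦ min 1 z² + |z| 1_{|z| ≥ 1}` controlling the jump operator. -/
noncomputable def jumpWeight (z : ℝ) : ℝ :=
  min 1 (z ^ 2) + {z : ℝ | 1 ≤ |z|}.indicator (fun z => |z|) z

lemma jumpWeight_nonneg (z : ℝ) : 0 ≤ jumpWeight z :=
  add_nonneg (le_min zero_le_one (sq_nonneg z)) (Set.indicator_nonneg (fun _ _ => abs_nonneg _) z)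

lemma integrable_jumpWeight {ν : Measure ℝ}
    (h1 : Integrable (fun z : ℝ => min 1 (z ^ 2)) ν)
    (h2 : IntegrableOn (fun z : ℝ => |z|) {z : ℝ | 1 ≤ |z|} ν) :
    Integrable jumpWeight ν :=
  h1.add (h2.integrable_indicator (measurableSet_le measurable_const measurable_id.abs))

lemma SchwartzMap.exists_norm_sub_mul_le_jumpWeight (f : SchwartzMap ℝ ℂ) :
    ∃ C, 0 < C ∧ ∀ x z : ℝ, ‖(f (x - z) - f x) * (z : ℂ)‖ ≤
      C * (jumpWeight z * (1 + (x - z) ^ 2)⁻¹ + jumpWeight z * (1 + x ^ 2)⁻¹) := by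
  obtain ⟨A, hA, hfA⟩ := f.exists_norm_le_inv_one_add_sq
  obtain ⟨B, hB, hfB⟩ := f.exists_norm_sub_le_abs_mul
  refine ⟨A + B, by positivity, fun x z => ?_⟩
  rw [norm_mul, Complex.norm_real, Real.norm_eq_abs]
  have hp : 0 < (1 + (x - z) ^ 2)⁻¹ := by positivity
  have hq : 0 < (1 + x ^ 2)⁻¹ := by positivity
  have hw := jumpWeight_nonneg z
  rcases le_or_gt 1 |z| with hz | hz
  · have hzw : |z| ≤ jumpWeight z := by
      rw [jumpWeight, Set.indicator_of_mem (by exact hz)]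
      linarith [le_min zero_le_one (sq_nonneg z)]
    calc ‖f (x - z) - f x‖ * |z|
        ≤ (A * (1 + (x - z) ^ 2)⁻¹ + A * (1 + x ^ 2)⁻¹) * jumpWeight z := by
          gcongr
          exact (norm_sub_le _ _).trans (add_le_add (hfA _) (hfA _))
      _ ≤ ((A + B) * (1 + (x - z) ^ 2)⁻¹ + (A + B) * (1 + x ^ 2)⁻¹) * jumpWeight z := by
          gcongr <;> linarith
      _ = _ := by ring
  · have hzw : z ^ 2 = jumpWeight z := by
      rw [jumpWeight, Set.indicator_of_notMem (by simpa using hz), add_zero,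
        min_eq_right ((sq_le_one_iff_abs_le_one z).2 hz.le)]
    calc ‖f (x - z) - f x‖ * |z| ≤ (B * |z| * (1 + x ^ 2)⁻¹) * |z| := by
          gcongr
          exact hfB x z hz.le
      _ = B * (jumpWeight z * (1 + x ^ 2)⁻¹) := by rw [← hzw, ← sq_abs z]; ring
      _ ≤ (A + B) * (jumpWeight z * (1 + x ^ 2)⁻¹) := by gcongr; linarith
      _ ≤ _ := by gcongr; linarith [mul_nonneg hw hp.le]

lemma SchwartzMap.integrable_sub_mul (f : SchwartzMap ℝ ℂ) {ν : Measure ℝ}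
    (hw : Integrable jumpWeight ν) (x : ℝ) :
    Integrable (fun z : ℝ => (f (x - z) - f x) * (z : ℂ)) ν := by
  obtain ⟨C, hC, hb⟩ := f.exists_norm_sub_mul_le_jumpWeight
  have hc := f.continuous
  refine (hw.const_mul (C * 2)).mono' (by fun_prop) (.of_forall fun z => (hb x z).trans ?_)
  have h (y : ℝ) : jumpWeight z * (1 + y ^ 2)⁻¹ ≤ jumpWeight z :=
    mul_le_of_le_one_right (jumpWeight_nonneg z) (inv_le_one_of_one_le₀ (by nlinarith))
  nlinarith [h x, h (x - z)]

lemma SchwartzMap.integrable_prod_sub_mul (f : SchwartzMap ℝ ℂ) {ν : Measure ℝ} [SFinite ν]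
    (hw : Integrable jumpWeight ν) :
    Integrable (fun p : ℝ × ℝ => (f (p.1 - p.2) - f p.1) * (p.2 : ℂ)) (volume.prod ν) := by
  obtain ⟨C, hC, hb⟩ := f.exists_norm_sub_mul_le_jumpWeight
  have hc := f.continuous
  have h₁ : Integrable (fun p : ℝ × ℝ => jumpWeight p.2 * (1 + (p.1 - p.2) ^ 2)⁻¹)
      (volume.prod ν) :=
    hw.convolution_integrand (ContinuousLinearMap.mul ℝ ℝ) integrable_inv_one_add_sq
  have h₂ : Integrable (fun p : ℝ × ℝ => jumpWeight p.2 * (1 + p.1 ^ 2)⁻¹) (volume.prod ν) := by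
    simpa only [mul_comm] using integrable_inv_one_add_sq.mul_prod hw
  exact ((h₁.add h₂).const_mul C).mono' (by fun_prop) (.of_forall fun p => hb p.1 p.2)

lemma norm_exp_I_mul_ofReal_mul_ofReal (x ξ : ℝ) :
    ‖Complex.exp (Complex.I * (x : ℂ) * (ξ : ℂ))‖ = 1 := by
  rw [mul_assoc, mul_comm, ← Complex.ofReal_mul, Complex.norm_exp_ofReal_mul_I]

lemma SchwartzMap.integrable_exp_mul (f : SchwartzMap ℝ ℂ) (ξ : ℝ) :
    Integrable (fun x : ℝ => Complex.exp (Complex.I * (x : ℂ) * (ξ : ℂ)) * f x) :=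
  f.integrable.bdd_mul (c := 1) (by fun_prop)
    (.of_forall fun x => (norm_exp_I_mul_ofReal_mul_ofReal x ξ).le)

lemma SchwartzMap.integral_exp_mul_sub_mul (f : SchwartzMap ℝ ℂ) (z ξ : ℝ) :
    ∫ x : ℝ, Complex.exp (Complex.I * (x : ℂ) * (ξ : ℂ)) * ((f (x - z) - f x) * (z : ℂ)) =
      (Complex.exp (Complex.I * (z : ℂ) * (ξ : ℂ)) - 1) * (z : ℂ) *
        ∫ x : ℝ, Complex.exp (Complex.I * (x : ℂ) * (ξ : ℂ)) * f x := by
  have hi := f.integrable_exp_mul ξ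
  have hshift (x : ℝ) : Complex.exp (Complex.I * (x : ℂ) * (ξ : ℂ)) * f (x - z) =
      Complex.exp (Complex.I * (z : ℂ) * (ξ : ℂ)) *
        (Complex.exp (Complex.I * ((x - z : ℝ) : ℂ) * (ξ : ℂ)) * f (x - z)) := by
    rw [← mul_assoc, ← Complex.exp_add]
    congr 2
    push_cast
    ring
  have hi' := (hi.comp_sub_right z).const_mul (Complex.exp (Complex.I * (z : ℂ) * (ξ : ℂ)))
  simp_rw [← mul_assoc, integral_mul_const, mul_sub, hshift]
  rw [integral_sub hi' hi, integral_const_mul,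
    integral_sub_right_eq_self
      (fun x : ℝ => Complex.exp (Complex.I * (x : ℂ) * (ξ : ℂ)) * f x) z]
  ring

/-- Fourier identity for the first-moment jump operator: for a Lévy-type measure `ν` with
`∫ min(1,z²) ν(dz) < ∞` and `∫_{|z|≥1} |z| ν(dz) < ∞`, and a Schwartz function `f`,
the function `g(x) = ∫ (f(x−z) − f(x)) z ν(dz)` is well defined and integrable, and
`ℱg(ξ) = (∫ (e^{izξ} − 1) z ν(dz)) ℱf(ξ)`. -/
theorem stmt12 (ν : Measure ℝ) [SigmaFinite ν]
    (h1 : Integrable (fun z : ℝ => min 1 (z ^ 2)) ν)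
    (h2 : IntegrableOn (fun z : ℝ => |z|) {z : ℝ | 1 ≤ |z|} ν)
    (f : SchwartzMap ℝ ℂ) :
    (∀ x : ℝ, Integrable (fun z : ℝ => (f (x - z) - f x) * (z : ℂ)) ν) ∧
    Integrable (fun x : ℝ => ∫ z : ℝ, (f (x - z) - f x) * (z : ℂ) ∂ν) ∧
    ∀ ξ : ℝ,
      (∫ x : ℝ, Complex.exp (Complex.I * (x : ℂ) * (ξ : ℂ)) *
          ∫ z : ℝ, (f (x - z) - f x) * (z : ℂ) ∂ν) =
        (∫ z : ℝ, (Complex.exp (Complex.I * (z : ℂ) * (ξ : ℂ)) - 1) * (z : ℂ) ∂ν) *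
          ∫ x : ℝ, Complex.exp (Complex.I * (x : ℂ) * (ξ : ℂ)) * f x := by
  have hw := integrable_jumpWeight h1 h2
  have hF := f.integrable_prod_sub_mul hw
  refine ⟨f.integrable_sub_mul hw, hF.integral_prod_left, fun ξ => ?_⟩
  have hE : Integrable (fun p : ℝ × ℝ => Complex.exp (Complex.I * (p.1 : ℂ) * (ξ : ℂ)) *
      ((f (p.1 - p.2) - f p.1) * (p.2 : ℂ))) (volume.prod ν) :=
    hF.bdd_mul (c := 1) (by fun_prop)
      (.of_forall fun p => (norm_exp_I_mul_ofReal_mul_ofReal p.1 ξ).le)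
  rw [← integral_mul_const]
  simp_rw [← f.integral_exp_mul_sub_mul]
  rw [← integral_integral_swap hE]
  simp_rw [integral_const_mul]
end

section
/- (First-order pointwise bound: n = 0 case of Proposition 5.2.) For every c > 1 and τ > 0 there exists a constant C > 0, depending only on c, τ and M, such that for all x, y ∈ ℝ and all t < T with 0 < T − t ≤ τ, one has |(x−y)² (∂_xx − ∂_x) p⁰(t,x;T,y)| ≤ C · Γ̄^{cM,cM,cM}(T−t, x−y), where the derivatives are taken in the backward spatial variable x. -/
open Real MeasureTheory

/-- Gaussian density component `Γ_n^{α,θ,ℓ}(t,x)`. -/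
noncomputable def Gn (α θ l : ℝ) (n : ℕ) (t x : ℝ) : ℝ :=
  (Real.sqrt (2 * Real.pi * (α * t + (n : ℝ) * θ)))⁻¹ *
    Real.exp (-(x - (α / 2 + l * (Real.exp (θ / 2) - 1)) * t) ^ 2 / (2 * (α * t + (n : ℝ) * θ)))

/-- Compound-Poisson jump-diffusion density `Γ^{α,θ,ℓ}(t,x)`. -/
noncomputable def G (α θ l : ℝ) (t x : ℝ) : ℝ :=
  Real.exp (-(l * t)) * ∑' n : ℕ, (l * t) ^ n / (Nat.factorial n : ℝ) * Gn α θ l n t x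

/-- Centered Gaussian density component `Γ̄_n^{α,θ}(t,x)`. -/
noncomputable def GBn (α θ : ℝ) (n : ℕ) (t x : ℝ) : ℝ :=
  (Real.sqrt (2 * Real.pi * (α * t + (n : ℝ) * θ)))⁻¹ *
    Real.exp (-x ^ 2 / (2 * (α * t + (n : ℝ) * θ)))

/-- Centered jump-diffusion density `Γ̄^{α,θ,ℓ}(t,x)`. -/
noncomputable def GB (α θ l : ℝ) (t x : ℝ) : ℝ :=
  Real.exp (-(l * t)) * ∑' n : ℕ, (l * t) ^ n / (Nat.factorial n : ℝ) * GBn α θ n t x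

/-- Gaussian convolution operator `𝒞_θ`. -/
noncomputable def conv (θ : ℝ) (f : ℝ → ℝ) (x : ℝ) : ℝ :=
  ∫ z : ℝ, f (x + z) * ((Real.sqrt (2 * Real.pi * θ))⁻¹ * Real.exp (-z ^ 2 / (2 * θ)))

/-- Zeroth-order parametrix `p⁰(t,x;T,y) := Γ^{a(y),δ²,λ(y)}(T−t, x−y)`. -/
noncomputable def p0 (a lam : ℝ → ℝ) (δ : ℝ) (t x T y : ℝ) : ℝ :=
  G (a y) (δ ^ 2) (lam y) (T - t) (x - y)

/-- The first derivative of a Gaussian density with mean `m` and variance `v`. -/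
lemma hasDerivAt_gaussian (k m v x : ℝ) :
    HasDerivAt (fun x => k * exp (-(x - m) ^ 2 / (2 * v)))
      (-((x - m) / v) * (k * exp (-(x - m) ^ 2 / (2 * v)))) x := by
  have h : HasDerivAt (fun x : ℝ => -(x - m) ^ 2 / (2 * v)) (-((x - m) / v)) x := by
    have := ((((hasDerivAt_id x).sub_const m).pow 2).neg).div_const (2 * v)
    refine this.congr_deriv ?_
    simp only [id]
    rcases eq_or_ne v 0 with rfl | hv
    · simp
    · field_simp
      norm_num
      ring
  refine (h.exp.const_mul k).congr_deriv ?_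
  ring

/-- The second derivative of a Gaussian density with mean `m` and variance `v`. -/
lemma hasDerivAt_deriv_gaussian (k m v x : ℝ) :
    HasDerivAt (fun x => -((x - m) / v) * (k * exp (-(x - m) ^ 2 / (2 * v))))
      (((x - m) ^ 2 / v ^ 2 - 1 / v) * (k * exp (-(x - m) ^ 2 / (2 * v)))) x := by
  have h : HasDerivAt (fun x : ℝ => -((x - m) / v)) (-(1 / v)) x :=
    (((hasDerivAt_id x).sub_const m).div_const v).neg
  refine (h.mul (hasDerivAt_gaussian k m v x)).congr_deriv ?_
  ring

lemma abs_mul_exp_neg_sq_le {v : ℝ} (hv : 0 < v) (w : ℝ) :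
    |w| / v * exp (-w ^ 2 / (2 * v)) ≤ 1 / v + 1 := by
  have hq : 0 ≤ w ^ 2 / (2 * v) := by positivity
  have h1 : exp (-w ^ 2 / (2 * v)) * (1 + w ^ 2 / (2 * v)) ≤ 1 := by
    have := add_one_le_exp (w ^ 2 / (2 * v))
    calc _ ≤ exp (-w ^ 2 / (2 * v)) * exp (w ^ 2 / (2 * v)) := by gcongr; linarith
      _ = 1 := by rw [← exp_add, neg_div, neg_add_cancel, exp_zero]
  have h2 : |w| / v ≤ (1 / v + 1) * (1 + w ^ 2 / (2 * v)) := by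
    have : |w| / v ≤ 1 / v + w ^ 2 / (2 * v) := by
      rw [show 1 / v + w ^ 2 / (2 * v) = (1 + w ^ 2 / 2) / v by field_simp]
      gcongr
      nlinarith [sq_nonneg (|w| - 1), sq_abs w]
    have : 0 ≤ 1 / v * (w ^ 2 / (2 * v)) := by positivity
    linarith
  calc _ ≤ (1 / v + 1) * (1 + w ^ 2 / (2 * v)) * exp (-w ^ 2 / (2 * v)) := by gcongr
    _ = (1 / v + 1) * (exp (-w ^ 2 / (2 * v)) * (1 + w ^ 2 / (2 * v))) := by ring
    _ ≤ _ := mul_le_of_le_one_right (by positivity) h1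

lemma abs_sq_sub_mul_exp_neg_sq_le {v : ℝ} (hv : 0 < v) (w : ℝ) :
    |w ^ 2 / v ^ 2 - 1 / v| * exp (-w ^ 2 / (2 * v)) ≤ 2 * (1 / v) := by
  have hq : 0 ≤ w ^ 2 / (2 * v) := by positivity
  have h1 : exp (-w ^ 2 / (2 * v)) * (1 + w ^ 2 / (2 * v)) ≤ 1 := by
    have := add_one_le_exp (w ^ 2 / (2 * v))
    calc _ ≤ exp (-w ^ 2 / (2 * v)) * exp (w ^ 2 / (2 * v)) := by gcongr; linarith
      _ = 1 := by rw [← exp_add, neg_div, neg_add_cancel, exp_zero]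
  have h2 : |w ^ 2 / v ^ 2 - 1 / v| ≤ 2 * (1 / v) * (1 + w ^ 2 / (2 * v)) := by
    have e : 2 * (1 / v) * (1 + w ^ 2 / (2 * v)) = 2 * (1 / v) + w ^ 2 / v ^ 2 := by
      field_simp
    have : 0 < 1 / v := by positivity
    have : 0 ≤ w ^ 2 / v ^ 2 := by positivity
    rw [e, abs_le]
    constructor <;> linarith
  calc _ ≤ 2 * (1 / v) * (1 + w ^ 2 / (2 * v)) * exp (-w ^ 2 / (2 * v)) := by gcongr
    _ = 2 * (1 / v) * (exp (-w ^ 2 / (2 * v)) * (1 + w ^ 2 / (2 * v))) := by ring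
    _ ≤ _ := mul_le_of_le_one_right (by positivity) h1

/-- A summable mixture of Gaussians with bounded prefactors and variances bounded below can be
differentiated twice term by term. -/
lemma mixture_derivs {p k v : ℕ → ℝ} {m v₀ D : ℝ} (hp : Summable p) (hp0 : ∀ n, 0 ≤ p n)
    (hv₀ : 0 < v₀) (hv : ∀ n, v₀ ≤ v n) (hk0 : ∀ n, 0 ≤ k n) (hk : ∀ n, k n ≤ D) :
    (∀ x, HasDerivAt (fun x => ∑' n, p n * (k n * exp (-(x - m) ^ 2 / (2 * v n))))
      (∑' n, p n * (-((x - m) / v n) * (k n * exp (-(x - m) ^ 2 / (2 * v n))))) x) ∧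
    (∀ x, HasDerivAt
      (fun x => ∑' n, p n * (-((x - m) / v n) * (k n * exp (-(x - m) ^ 2 / (2 * v n)))))
      (∑' n, p n * (((x - m) ^ 2 / v n ^ 2 - 1 / v n) *
        (k n * exp (-(x - m) ^ 2 / (2 * v n))))) x) ∧
    (∀ x, Summable fun n => p n * (-((x - m) / v n) * (k n * exp (-(x - m) ^ 2 / (2 * v n))))) ∧
    (∀ x, Summable fun n => p n * (((x - m) ^ 2 / v n ^ 2 - 1 / v n) *
        (k n * exp (-(x - m) ^ 2 / (2 * v n))))) := by
  have hvp : ∀ n, 0 < v n := fun n => hv₀.trans_le (hv n)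
  have hinv : ∀ n, 1 / v n ≤ 1 / v₀ := fun n => one_div_le_one_div_of_le hv₀ (hv n)
  have hinv0 : ∀ n, 0 < 1 / v n := fun n => one_div_pos.2 (hvp n)
  have b0 : ∀ n x, ‖p n * (k n * exp (-(x - m) ^ 2 / (2 * v n)))‖ ≤ p n * D := by
    intro n x
    rw [norm_of_nonneg (mul_nonneg (hp0 n) (mul_nonneg (hk0 n) (exp_nonneg _)))]
    refine mul_le_mul_of_nonneg_left ?_ (hp0 n)
    refine (mul_le_of_le_one_right (hk0 n) (exp_le_one_iff.2 ?_)).trans (hk n)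
    rw [neg_div]
    have := hvp n
    have : 0 ≤ (x - m) ^ 2 / (2 * v n) := by positivity
    linarith
  have b1 : ∀ n x, ‖p n * (-((x - m) / v n) * (k n * exp (-(x - m) ^ 2 / (2 * v n))))‖ ≤
      p n * (D * (1 / v₀ + 1)) := by
    intro n x
    rw [norm_mul, norm_of_nonneg (hp0 n)]
    refine mul_le_mul_of_nonneg_left ?_ (hp0 n)
    rw [norm_mul, norm_of_nonneg (mul_nonneg (hk0 n) (exp_nonneg _)), norm_neg, norm_eq_abs,
      abs_div, abs_of_pos (hvp n), mul_left_comm]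
    have := abs_mul_exp_neg_sq_le (hvp n) (x - m)
    exact mul_le_mul (hk n) (this.trans (by linarith [hinv n]))
      (mul_nonneg (div_nonneg (abs_nonneg _) (hvp n).le) (exp_nonneg _)) ((hk0 n).trans (hk n))
  have b2 : ∀ n x, ‖p n * (((x - m) ^ 2 / v n ^ 2 - 1 / v n) *
      (k n * exp (-(x - m) ^ 2 / (2 * v n))))‖ ≤ p n * (D * (2 * (1 / v₀))) := by
    intro n x
    rw [norm_mul, norm_of_nonneg (hp0 n)]
    refine mul_le_mul_of_nonneg_left ?_ (hp0 n)
    rw [norm_mul, norm_of_nonneg (mul_nonneg (hk0 n) (exp_nonneg _)), norm_eq_abs, mul_left_comm]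
    have := abs_sq_sub_mul_exp_neg_sq_le (hvp n) (x - m)
    exact mul_le_mul (hk n) (this.trans (by linarith [hinv n]))
      (mul_nonneg (abs_nonneg _) (exp_nonneg _)) ((hk0 n).trans (hk n))
  have s0 := fun x => Summable.of_norm_bounded (hp.mul_right D) (fun n => b0 n x)
  have s1 := fun x => Summable.of_norm_bounded (hp.mul_right _) (fun n => b1 n x)
  have s2 := fun x => Summable.of_norm_bounded (hp.mul_right _) (fun n => b2 n x)
  exact ⟨hasDerivAt_tsum (hp.mul_right _)
      (fun n x => (hasDerivAt_gaussian (k n) m (v n) x).const_mul (p n)) b1 (s0 0),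
    hasDerivAt_tsum (hp.mul_right _)
      (fun n x => (hasDerivAt_deriv_gaussian (k n) m (v n) x).const_mul (p n)) b2 (s1 0), s1, s2⟩

/-- Polynomial factors and a shift of size `O(√v)` are absorbed by enlarging the variance of a
Gaussian by a factor `c > 1`. -/
lemma sq_mul_gaussian_le {c K : ℝ} (hc : 1 < c) (hK : 0 ≤ K) :
    ∃ C : ℝ, 0 < C ∧ ∀ z d v : ℝ, 0 < v → d ^ 2 ≤ K * v →
      z ^ 2 * ((z - d) ^ 2 / v ^ 2 + 1 / v + |z - d| / v) * exp (-(z - d) ^ 2 / (2 * v)) ≤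
        C * (1 + v) * exp (-z ^ 2 / (2 * (c * v))) := by
  have hc0 : 0 < c := by linarith
  obtain ⟨ρ, hρ⟩ : ∃ ρ, ρ = (c - 1) / 2 := ⟨_, rfl⟩
  obtain ⟨κ, hκ⟩ : ∃ κ, κ = (c - 1) / (4 * c) := ⟨_, rfl⟩
  have hρ0 : 0 < ρ := by rw [hρ]; linarith
  have hκ0 : 0 < κ := by rw [hκ]; exact div_pos (by linarith) (by linarith)
  have hκ1 : κ ≤ 1 := by rw [hκ, div_le_one (by linarith)]; linarith
  have hκρ : (1 + ρ) / c = 1 - 2 * κ := by rw [hρ, hκ]; field_simp; ring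
  refine ⟨(8 + 4 * K) / κ ^ 2 * exp ((1 + 1 / ρ) * K / (2 * c)), by positivity, ?_⟩
  intro z d v hv hd
  obtain ⟨w, hw⟩ : ∃ w, w = z - d := ⟨_, rfl⟩
  obtain ⟨q, hq⟩ : ∃ q, q = w ^ 2 / (2 * v) := ⟨_, rfl⟩
  have hz : z = w + d := by rw [hw]; ring
  have hq0 : 0 ≤ q := by rw [hq]; positivity
  have hwq : w ^ 2 = 2 * v * q := by rw [hq]; field_simp
  have hz2 : z ^ 2 ≤ v * (4 * q + 2 * K) := by
    rw [hz]; nlinarith [sq_nonneg (w - d)]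
  have habs : |w| ≤ 1 / 2 + v * q := by
    nlinarith [sq_nonneg (|w| - 1), sq_abs w]
  have hpoly : w ^ 2 / v ^ 2 + 1 / v + |w| / v ≤ (2 * q + 3 / 2 + v * q) / v := by
    rw [hwq, show 2 * v * q / v ^ 2 = 2 * q / v by field_simp, ← add_div, ← add_div]
    exact div_le_div_of_nonneg_right (by linarith) hv.le
  have hmain : z ^ 2 * (w ^ 2 / v ^ 2 + 1 / v + |w| / v) ≤
      (8 + 4 * K) * (1 + v) * (1 + q) ^ 2 := by
    calc _ ≤ (v * (4 * q + 2 * K)) * ((2 * q + 3 / 2 + v * q) / v) := by gcongr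
      _ = (4 * q + 2 * K) * (2 * q + 3 / 2 + v * q) := by field_simp
      _ ≤ ((4 + 2 * K) * (1 + q)) * (2 * ((1 + v) * (1 + q))) := by
          have := mul_nonneg hK hq0
          have := mul_nonneg hv.le hq0
          gcongr <;> nlinarith
      _ = _ := by ring
  have hexp : (1 + q) ^ 2 ≤ exp (2 * κ * q) / κ ^ 2 := by
    have h := add_one_le_exp (κ * q)
    rw [le_div_iff₀ (by positivity), show 2 * κ * q = κ * q + κ * q by ring, exp_add, ← mul_pow,
      ← sq]
    gcongr
    linarith
  have hgauss : 2 * κ * q + -w ^ 2 / (2 * v) ≤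
      (1 + 1 / ρ) * K / (2 * c) + -z ^ 2 / (2 * (c * v)) := by
    have h1 : z ^ 2 ≤ (1 + ρ) * w ^ 2 + (1 + 1 / ρ) * d ^ 2 := by
      have : (1 + ρ) * w ^ 2 + (1 + 1 / ρ) * d ^ 2 - z ^ 2 = (ρ * w - d) ^ 2 / ρ := by
        rw [hz]; field_simp; ring
      have : 0 ≤ (ρ * w - d) ^ 2 / ρ := by positivity
      linarith
    have h2 : z ^ 2 / (2 * (c * v)) ≤ (1 + ρ) / c * q + (1 + 1 / ρ) * K / (2 * c) := by
      calc z ^ 2 / (2 * (c * v))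
          ≤ ((1 + ρ) * w ^ 2 + (1 + 1 / ρ) * (K * v)) / (2 * (c * v)) := by
            gcongr
            refine h1.trans ?_
            gcongr
        _ = _ := by rw [hq]; field_simp
    rw [hκρ] at h2
    rw [neg_div, neg_div, ← hq]
    linarith
  rw [← hw]
  calc _ ≤ (8 + 4 * K) * (1 + v) * (exp (2 * κ * q) / κ ^ 2) * exp (-w ^ 2 / (2 * v)) := by
        refine mul_le_mul_of_nonneg_right (hmain.trans ?_) (exp_nonneg _)
        gcongr
    _ = (8 + 4 * K) / κ ^ 2 * (1 + v) * exp (2 * κ * q + -w ^ 2 / (2 * v)) := by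
        rw [exp_add]; ring
    _ ≤ (8 + 4 * K) / κ ^ 2 * (1 + v) *
          exp ((1 + 1 / ρ) * K / (2 * c) + -z ^ 2 / (2 * (c * v))) := by gcongr
    _ = _ := by rw [exp_add]; ring

/-- Termwise form of the estimate: the loss in the time index is geometric. -/
lemma sq_mul_component_le {M c τ B : ℝ} (hM : 1 ≤ M) (hc : 1 < c) (hτ : 0 < τ) :
    ∃ C : ℝ, 0 < C ∧ ∀ (α θ b s z : ℝ) (n : ℕ), M⁻¹ ≤ α → α ≤ M → M⁻¹ ≤ θ → θ ≤ M → |b| ≤ B →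
      0 < s → s ≤ τ →
      z ^ 2 * ((z - b * s) ^ 2 / (α * s + n * θ) ^ 2 + 1 / (α * s + n * θ) +
          |z - b * s| / (α * s + n * θ)) *
        ((√(2 * π * (α * s + n * θ)))⁻¹ * exp (-(z - b * s) ^ 2 / (2 * (α * s + n * θ)))) ≤
        C * c ^ n * GBn (c * M) (c * M) n s z := by
  obtain ⟨C, hC, h⟩ := sq_mul_gaussian_le (K := B ^ 2 * τ * M) hc (by positivity)
  have hc1 : 0 < c - 1 := by linarith
  refine ⟨C * (1 + M * τ + M / (c - 1)) * √(c * M ^ 2), by positivity, ?_⟩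
  intro α θ b s z n hα hα' hθ hθ' hb hs hsτ
  have hM0 : 0 < M := by linarith
  have hn : (0 : ℝ) ≤ n := n.cast_nonneg
  have hα0 : 0 < α := (inv_pos.2 hM0).trans_le hα
  have hθ0 : 0 < θ := (inv_pos.2 hM0).trans_le hθ
  have hMα : 1 ≤ M * α := by rwa [inv_le_iff_one_le_mul₀' hM0] at hα
  have hMθ : 1 ≤ M * θ := by rwa [inv_le_iff_one_le_mul₀' hM0] at hθ
  obtain ⟨v, hv⟩ : ∃ v, v = α * s + n * θ := ⟨_, rfl⟩
  have hv0 : 0 < v := by rw [hv]; positivity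
  have hvs : s + n ≤ M * v := by
    rw [hv]
    nlinarith [mul_le_mul_of_nonneg_right hMα hs.le, mul_le_mul_of_nonneg_right hMθ hn]
  have hvM : v ≤ M * s + n * M := by rw [hv]; gcongr
  have hV : c * M * s + n * (c * M) = c * (M * s + n * M) := by ring
  have hd : (b * s) ^ 2 ≤ B ^ 2 * τ * M * v := by
    calc (b * s) ^ 2 = b ^ 2 * (s * s) := by ring
      _ ≤ B ^ 2 * (τ * (M * v)) := by
          have : b ^ 2 ≤ B ^ 2 := by rw [← sq_abs b]; gcongr
          have : s ≤ M * v := by linarith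
          gcongr
      _ = _ := by ring
  have hgeo : 1 + v ≤ (1 + M * τ + M / (c - 1)) * c ^ n := by
    have h1 : 1 + n * (c - 1) ≤ c ^ n := by
      have := one_add_mul_le_pow (a := c - 1) (by linarith) n
      simpa using this
    have h2 : (1 : ℝ) ≤ c ^ n := one_le_pow₀ hc.le
    have h3 : (n : ℝ) * M ≤ M / (c - 1) * c ^ n := by
      calc (n : ℝ) * M = M / (c - 1) * (n * (c - 1)) := by field_simp
        _ ≤ _ := by gcongr; linarith
    have h4 : 1 + M * τ ≤ (1 + M * τ) * c ^ n := le_mul_of_one_le_right (by positivity) h2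
    have h5 : M * s ≤ M * τ := by gcongr
    linarith
  have hpre : (√(2 * π * v))⁻¹ ≤ √(c * M ^ 2) * (√(2 * π * (c * (M * s + n * M))))⁻¹ := by
    have h1 : √(2 * π * (c * (M * s + n * M))) ≤ √(c * M ^ 2) * √(2 * π * v) := by
      rw [← sqrt_mul (by positivity)]
      apply sqrt_le_sqrt
      calc 2 * π * (c * (M * s + n * M)) = 2 * π * (c * M) * (s + n) := by ring
        _ ≤ 2 * π * (c * M) * (M * v) := by gcongr
        _ = _ := by ring
    have h2 : 0 < √(2 * π * (c * (M * s + n * M))) := sqrt_pos.2 (by positivity)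
    have h3 : 0 < √(2 * π * v) := sqrt_pos.2 (by positivity)
    rw [← div_eq_mul_inv, le_div_iff₀ h2, inv_mul_le_iff₀ h3]
    linarith
  have hexp : exp (-z ^ 2 / (2 * (c * v))) ≤ exp (-z ^ 2 / (2 * (c * (M * s + n * M)))) := by
    rw [exp_le_exp, neg_div, neg_div, neg_le_neg_iff]
    gcongr
  rw [GBn, hV, ← hv]
  calc _ = (z ^ 2 * ((z - b * s) ^ 2 / v ^ 2 + 1 / v + |z - b * s| / v) *
          exp (-(z - b * s) ^ 2 / (2 * v))) * (√(2 * π * v))⁻¹ := by ring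
    _ ≤ (C * ((1 + M * τ + M / (c - 1)) * c ^ n) *
          exp (-z ^ 2 / (2 * (c * (M * s + n * M))))) *
          (√(c * M ^ 2) * (√(2 * π * (c * (M * s + n * M))))⁻¹) := by
        refine mul_le_mul ((h z (b * s) v hv0 hd).trans ?_) hpre (by positivity) (by positivity)
        gcongr
    _ = _ := by ring

lemma summable_GBn {α θ s : ℝ} (l z : ℝ) (hα : 0 < α) (hθ : 0 ≤ θ) (hs : 0 < s) (hl : 0 ≤ l) :
    Summable fun n : ℕ => (l * s) ^ n / (Nat.factorial n : ℝ) * GBn α θ n s z := by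
  refine Summable.of_nonneg_of_le (fun n => ?_) (fun n => ?_)
    ((Real.summable_pow_div_factorial (l * s)).mul_right (√(2 * π * (α * s)))⁻¹)
  · unfold GBn; positivity
  · have : 0 < α * s := mul_pos hα hs
    have h0 : 0 ≤ (n : ℝ) * θ := by positivity
    refine mul_le_mul_of_nonneg_left ?_ (by positivity)
    unfold GBn
    refine (mul_le_of_le_one_right (by positivity) (exp_le_one_iff.2 ?_)).trans ?_
    · rw [neg_div]
      have : 0 ≤ z ^ 2 / (2 * (α * s + n * θ)) := by positivity
      linarith
    · gcongr
      linarith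

/-- Proposition 5.2 (case `n = 0`): `|(x−y)² (∂_xx − ∂_x) p⁰(t,x;T,y)| ≤ C Γ̄^{cM,cM,cM}(T−t,x−y)`. -/
theorem stmt15 (M c τ : ℝ) (hM : 1 ≤ M) (hc : 1 < c) (hτ : 0 < τ) :
    ∃ C : ℝ, 0 < C ∧
      ∀ (δ : ℝ) (a lam : ℝ → ℝ),
        0 < δ → M⁻¹ ≤ δ ^ 2 → δ ^ 2 ≤ M →
        (∀ w : ℝ, M⁻¹ ≤ a w) → (∀ w : ℝ, a w ≤ M) →
        (∀ w : ℝ, 0 ≤ lam w) → (∀ w : ℝ, lam w ≤ M) →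
        ∀ x y t T : ℝ, t < T → T - t ≤ τ →
          |(x - y) ^ 2 *
              (deriv (deriv (fun w => p0 a lam δ t w T y)) x
                - deriv (fun w => p0 a lam δ t w T y) x)| ≤
            C * GB (c * M) (c * M) (c * M) (T - t) (x - y) := by
  have hM0 : 0 < M := by linarith
  obtain ⟨C, hC, hterm⟩ :=
    sq_mul_component_le (B := M / 2 + M * (exp (M / 2) - 1)) hM hc hτ
  refine ⟨C * exp (c * M * τ), by positivity, ?_⟩
  intro δ a lam _ hδ hδ' ha ha' hl hl' x y t T htT hTτ
  obtain ⟨s, hs⟩ : ∃ s, s = T - t := ⟨_, rfl⟩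
  have hs0 : 0 < s := by linarith
  rw [← hs] at hTτ
  generalize hθ : δ ^ 2 = θ at hδ hδ'
  specialize ha y
  specialize ha' y
  specialize hl y
  specialize hl' y
  simp only [p0, ← hs, hθ]
  generalize a y = α at *
  generalize lam y = l at *
  generalize hz : x - y = z
  have hα0 : 0 < α := (inv_pos.2 hM0).trans_le ha
  have hθ0 : 0 < θ := (inv_pos.2 hM0).trans_le hδ
  have hαs : 0 < α * s := mul_pos hα0 hs0
  obtain ⟨b, hb⟩ : ∃ b, b = α / 2 + l * (exp (θ / 2) - 1) := ⟨_, rfl⟩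
  have hbB : |b| ≤ M / 2 + M * (exp (M / 2) - 1) := by
    have h1 : 0 ≤ exp (θ / 2) - 1 := by linarith [one_le_exp (by linarith : 0 ≤ θ / 2)]
    have h2 : exp (θ / 2) ≤ exp (M / 2) := by gcongr
    rw [hb, abs_of_nonneg (by positivity)]
    gcongr
  obtain ⟨p, hp⟩ : ∃ p : ℕ → ℝ, p = fun n => (l * s) ^ n / (Nat.factorial n : ℝ) := ⟨_, rfl⟩
  have hp0 : ∀ n, 0 ≤ p n := fun n => by rw [hp]; positivity
  have hps : Summable p := hp ▸ Real.summable_pow_div_factorial (l * s)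
  obtain ⟨v, hv⟩ : ∃ v : ℕ → ℝ, v = fun n : ℕ => α * s + n * θ := ⟨_, rfl⟩
  have hvs : ∀ n, α * s ≤ v n := fun n => by
    have : 0 ≤ (n : ℝ) * θ := by positivity
    simp only [hv]
    linarith
  obtain ⟨k, hk⟩ : ∃ k : ℕ → ℝ, k = fun n => (√(2 * π * v n))⁻¹ := ⟨_, rfl⟩
  have hk0 : ∀ n, 0 ≤ k n := fun n => by rw [hk]; positivity
  have hkD : ∀ n, k n ≤ (√(2 * π * (α * s)))⁻¹ := fun n => by
    have := hvs n
    simp only [hk]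
    gcongr
  obtain ⟨d1, d2, s1, s2⟩ := mixture_derivs (m := b * s) hps hp0 hαs hvs hk0 hkD
  have hG : (fun w => G α θ l s (w - y)) = fun w => exp (-(l * s)) *
      (fun u => ∑' n, p n * (k n * exp (-(u - b * s) ^ 2 / (2 * v n)))) (w - y) := by
    funext w
    simp only [G, Gn, hp, hk, hv, hb]
  have D1 := fun w => ((d1 (w - y)).comp_sub_const w y).const_mul (exp (-(l * s)))
  have D2 := fun w => ((d2 (w - y)).comp_sub_const w y).const_mul (exp (-(l * s)))
  have e1 := funext fun w => (D1 w).deriv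
  rw [hG, e1, (D2 x).deriv]
  beta_reduce
  rw [hz, ← mul_sub, ← (s2 z).tsum_sub (s1 z)]
  have hV : Summable fun n : ℕ => (c * M * s) ^ n / (Nat.factorial n : ℝ) *
      GBn (c * M) (c * M) n s z :=
    summable_GBn _ z (by positivity) (by positivity) hs0 (by positivity)
  have hbound : ∀ n, ‖z ^ 2 * (p n * (((z - b * s) ^ 2 / v n ^ 2 - 1 / v n) *
        (k n * exp (-(z - b * s) ^ 2 / (2 * v n)))) -
      p n * (-((z - b * s) / v n) * (k n * exp (-(z - b * s) ^ 2 / (2 * v n)))))‖ ≤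
      C * ((c * M * s) ^ n / (Nat.factorial n : ℝ) * GBn (c * M) (c * M) n s z) := by
    intro n
    have hvn : 0 < v n := hαs.trans_le (hvs n)
    have hpn : p n ≤ (M * s) ^ n / (Nat.factorial n : ℝ) := by
      simp only [hp]
      gcongr
    have ht := hterm α θ b s z n ha ha' hδ hδ' hbB hs0 hTτ
    have hvn' : α * s + n * θ = v n := by rw [hv]
    rw [hvn'] at ht
    have hkn : (√(2 * π * v n))⁻¹ = k n := by rw [hk]
    rw [hkn] at ht
    have habs : |(z - b * s) ^ 2 / v n ^ 2 - 1 / v n + (z - b * s) / v n| ≤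
        (z - b * s) ^ 2 / v n ^ 2 + 1 / v n + |z - b * s| / v n := by
      have h1 : |(z - b * s) / v n| = |z - b * s| / v n := by rw [abs_div, abs_of_pos hvn]
      have h2 : 0 < 1 / v n := by positivity
      have h3 : 0 ≤ (z - b * s) ^ 2 / v n ^ 2 := by positivity
      rw [← h1, abs_le]
      constructor <;> linarith [neg_abs_le ((z - b * s) / v n), le_abs_self ((z - b * s) / v n)]
    have hg0 : 0 ≤ k n * exp (-(z - b * s) ^ 2 / (2 * v n)) := mul_nonneg (hk0 n) (exp_nonneg _)
    calc _ = ‖p n * (z ^ 2 * ((z - b * s) ^ 2 / v n ^ 2 - 1 / v n + (z - b * s) / v n) *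
          (k n * exp (-(z - b * s) ^ 2 / (2 * v n))))‖ := by congr 1; ring
      _ = p n * (z ^ 2 * |(z - b * s) ^ 2 / v n ^ 2 - 1 / v n + (z - b * s) / v n| *
          (k n * exp (-(z - b * s) ^ 2 / (2 * v n)))) := by
        rw [norm_mul, norm_mul, norm_mul, norm_of_nonneg (hp0 n), norm_of_nonneg (sq_nonneg z),
          norm_of_nonneg hg0, norm_eq_abs]
      _ ≤ (M * s) ^ n / (Nat.factorial n : ℝ) * (C * c ^ n * GBn (c * M) (c * M) n s z) := by
        refine mul_le_mul hpn (le_trans ?_ ht) (by positivity) (by positivity)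
        gcongr
      _ = _ := by rw [mul_assoc c M s, mul_pow c]; ring
  have hfin := tsum_of_norm_bounded (hV.mul_left C).hasSum hbound
  rw [tsum_mul_left, tsum_mul_left, norm_eq_abs] at hfin
  have hexp : exp (-(l * s)) ≤ exp (c * M * τ) * exp (-(c * M * s)) := by
    rw [← exp_add, exp_le_exp]
    have : c * M * s ≤ c * M * τ := by gcongr
    have : 0 ≤ l * s := by positivity
    linarith
  rw [mul_left_comm, abs_mul, abs_of_pos (exp_pos _), GB]
  calc _ ≤ (exp (c * M * τ) * exp (-(c * M * s))) * _ :=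
        mul_le_mul hexp hfin (abs_nonneg _) (by positivity)
    _ = _ := by ring
end

section
/- (n = 0 case of Proposition 5.4.) For every c > 1 and τ > 0 there exists a constant C > 0, depending only on c, τ and M, such that for all x, y ∈ ℝ and all t < T with 0 < T − t ≤ τ, one has |(x−y)² ( (e^{δ²/2} − 1) ∂_x p⁰(t,x;T,y) + (𝒞_{δ²} p⁰(t,·;T,y))(x) − p⁰(t,x;T,y) )| ≤ C · [ Γ̄^{cM,cM,cM}(T−t, x−y) + (𝒞_{cM} Γ̄^{cM,cM,cM}(T−t, ·))(x−y) ], where ∂_x and 𝒞_{δ²} act on the backward spatial variable x. -/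
open Real MeasureTheory

/-- The Gaussian density with variance `v`. -/
noncomputable def gauss (v x : ℝ) : ℝ :=
  (Real.sqrt (2 * Real.pi * v))⁻¹ * Real.exp (-x ^ 2 / (2 * v))

lemma gauss_nonneg (v x : ℝ) : 0 ≤ gauss v x := by
  unfold gauss; positivity

lemma continuous_gauss (v : ℝ) : Continuous (gauss v) := by
  unfold gauss; fun_prop

lemma gauss_le {v₀ v : ℝ} (h₀ : 0 < v₀) (h : v₀ ≤ v) (x : ℝ) :
    gauss v x ≤ (Real.sqrt (2 * Real.pi * v₀))⁻¹ := by
  have hv : 0 < v := h₀.trans_le h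
  have h1 : Real.exp (-x ^ 2 / (2 * v)) ≤ 1 := by
    rw [Real.exp_le_one_iff]
    exact div_nonpos_of_nonpos_of_nonneg (by nlinarith [sq_nonneg x]) (by positivity)
  have h2 : (Real.sqrt (2 * Real.pi * v))⁻¹ ≤ (Real.sqrt (2 * Real.pi * v₀))⁻¹ := by
    gcongr
  calc gauss v x ≤ (Real.sqrt (2 * Real.pi * v))⁻¹ * 1 := by
        unfold gauss; gcongr
    _ ≤ _ := by simpa using h2

lemma hasDerivAt_gauss {v : ℝ} (hv : 0 < v) (x : ℝ) :
    HasDerivAt (gauss v) (-(x / v) * gauss v x) x := by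
  have h1 : HasDerivAt (fun x : ℝ => -x ^ 2 / (2 * v)) (-(x / v)) x := by
    have := ((hasDerivAt_pow 2 x).neg).div_const (2 * v)
    refine this.congr_deriv ?_
    field_simp
    norm_num
  refine (h1.exp.const_mul (Real.sqrt (2 * Real.pi * v))⁻¹).congr_deriv ?_
  unfold gauss
  ring

lemma sq_one_add_le_exp {k y : ℝ} (hk : 0 < k) (hk1 : k ≤ 1) (hy : 0 ≤ y) :
    (1 + y) ^ 2 ≤ (k⁻¹) ^ 2 * Real.exp (2 * (k * y)) := by
  have h1 : 1 + y ≤ k⁻¹ * Real.exp (k * y) := by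
    have h2 : 1 + k * y ≤ Real.exp (k * y) := by linarith [Real.add_one_le_exp (k * y)]
    calc 1 + y = k⁻¹ * (k + k * y) := by field_simp
      _ ≤ k⁻¹ * Real.exp (k * y) := by gcongr; linarith
  calc (1 + y) ^ 2 ≤ (k⁻¹ * Real.exp (k * y)) ^ 2 := by gcongr
    _ = _ := by rw [mul_pow, ← Real.exp_nat_mul]; norm_num

/-- The quadratic weights of `weighted_gauss_le` grow at most polynomially in `(X - m) ^ 2 / v`. -/
lemma weight_le {v X m K : ℝ} (hv : 0 < v) (hK : 0 ≤ K) (hm : m ^ 2 ≤ K * v) :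
    1 + X ^ 2 + X ^ 2 * |(X - m) / v| ≤
      (5 + 4 * K) * (1 + v) * (1 + (X - m) ^ 2 / v) ^ 2 := by
  set r := Real.sqrt v with hr
  have hr0 : 0 < r := Real.sqrt_pos.2 hv
  have hrv : v = r ^ 2 := (Real.sq_sqrt hv.le).symm
  set w := |X - m| / r with hw
  have hw0 : 0 ≤ w := by positivity
  have hw2 : (X - m) ^ 2 / v = w ^ 2 := by rw [hw, div_pow, sq_abs, hrv]
  have habs : |(X - m) / v| = w / r := by
    rw [abs_div, abs_of_pos hv, hw, hrv]; field_simp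
  have hX : X ^ 2 ≤ 2 * v * (w ^ 2 + K) := by
    have : (X - m) ^ 2 = w ^ 2 * v := by rw [← hw2]; field_simp
    nlinarith [sq_nonneg (X - m - m)]
  rw [habs, hw2]
  have hX2 : X ^ 2 * (w / r) ≤ 2 * r * (w ^ 2 + K) * w := by
    calc X ^ 2 * (w / r) ≤ 2 * v * (w ^ 2 + K) * (w / r) := by gcongr
      _ = _ := by rw [hrv]; field_simp
  have hr1 : r ≤ 1 + v := by rw [hrv]; nlinarith [sq_nonneg (r - 1)]
  have hw1 : w ≤ 1 + w ^ 2 := by nlinarith [sq_nonneg (w - 1)]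
  have hwK : w ^ 2 + K ≤ (1 + K) * (1 + w ^ 2) := by nlinarith [mul_nonneg hK (sq_nonneg w)]
  have hq : 1 ≤ 1 + w ^ 2 := by nlinarith [sq_nonneg w]
  have hqq : 1 + w ^ 2 ≤ (1 + w ^ 2) ^ 2 := by nlinarith
  have e1 : 2 * v * (w ^ 2 + K) ≤ 2 * (1 + v) * ((1 + K) * (1 + w ^ 2) ^ 2) := by
    gcongr
    · linarith
    · exact hwK.trans (by gcongr)
  have e2 : 2 * r * (w ^ 2 + K) * w ≤ 2 * (1 + v) * ((1 + K) * (1 + w ^ 2)) * (1 + w ^ 2) := by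
    gcongr
  have e3 : 1 ≤ (1 + v) * (1 + w ^ 2) ^ 2 := by nlinarith
  nlinarith

lemma exp_shift_le {c v V X m K : ℝ} (hc : 1 < c) (hv : 0 < v) (hV : c * v ≤ V)
    (hm : m ^ 2 ≤ K * v) :
    -(X - m) ^ 2 / (2 * v) ≤
      -X ^ 2 / (2 * V) + (1 + 2 / (c - 1)) * K / (2 * c)
        - (c - 1) / (4 * c) * ((X - m) ^ 2 / v) := by
  have hc0 : 0 < c - 1 := by linarith
  have hc1 : 0 < c := by linarith
  have h1 : X ^ 2 / (2 * V) ≤ X ^ 2 / (2 * (c * v)) := by gcongr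
  have h2 : X ^ 2 ≤ (1 + c) / 2 * (X - m) ^ 2 + (1 + 2 / (c - 1)) * (K * v) := by
    have h3 : X ^ 2 ≤ (1 + c) / 2 * (X - m) ^ 2 + (1 + 2 / (c - 1)) * m ^ 2 := by
      have : (1 + c) / 2 * (X - m) ^ 2 + (1 + 2 / (c - 1)) * m ^ 2 - X ^ 2
          = (2 * (c - 1))⁻¹ * ((c - 1) * (X - m) - 2 * m) ^ 2 := by
        field_simp; ring
      have h4 : 0 ≤ (2 * (c - 1))⁻¹ * ((c - 1) * (X - m) - 2 * m) ^ 2 := by positivity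
      linarith
    have h5 : (1 + 2 / (c - 1)) * m ^ 2 ≤ (1 + 2 / (c - 1)) * (K * v) := by gcongr
    linarith
  have h6 : X ^ 2 / (2 * (c * v)) ≤
      ((1 + c) / 2 * (X - m) ^ 2 + (1 + 2 / (c - 1)) * (K * v)) / (2 * (c * v)) := by gcongr
  have h7 : ((1 + c) / 2 * (X - m) ^ 2 + (1 + 2 / (c - 1)) * (K * v)) / (2 * (c * v))
      = (X - m) ^ 2 / (2 * v) - (c - 1) / (4 * c) * ((X - m) ^ 2 / v)
        + (1 + 2 / (c - 1)) * K / (2 * c) := by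
    field_simp; ring
  rw [neg_div, neg_div]
  linarith

lemma sqrt_inv_le {v V L : ℝ} (hv : 0 < v) (hV0 : 0 < V) (hL : 0 ≤ L) (hVL : V ≤ L * v) :
    (Real.sqrt (2 * Real.pi * v))⁻¹ ≤ Real.sqrt L * (Real.sqrt (2 * Real.pi * V))⁻¹ := by
  have hp := Real.pi_pos
  have h1 : Real.sqrt (2 * Real.pi * V) ≤ Real.sqrt L * Real.sqrt (2 * Real.pi * v) := by
    rw [← Real.sqrt_mul hL]
    apply Real.sqrt_le_sqrt
    nlinarith
  have h2 : 0 < Real.sqrt (2 * Real.pi * v) := by positivity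
  have h3 : 0 < Real.sqrt (2 * Real.pi * V) := by positivity
  rw [inv_le_iff_one_le_mul₀ h2]
  rw [mul_right_comm, ← div_eq_mul_inv, le_div_iff₀ h3]
  linarith

/-- A shifted Gaussian with a polynomial weight is dominated by a wider centered Gaussian. -/
lemma weighted_gauss_le {c : ℝ} (hc : 1 < c) {K L : ℝ} (hK : 0 ≤ K) (hL : 0 ≤ L) :
    ∃ D : ℝ, 0 ≤ D ∧ ∀ v V X m : ℝ, 0 < v → c * v ≤ V → V ≤ L * v → m ^ 2 ≤ K * v →
      (1 + X ^ 2 + X ^ 2 * |(X - m) / v|) * gauss v (X - m) ≤ D * (1 + v) * gauss V X := by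
  have hc0 : 0 < c - 1 := by linarith
  have hc1 : 0 < c := by linarith
  set k := (c - 1) / (8 * c) with hkdef
  have hk : 0 < k := by positivity
  have hk1 : k ≤ 1 := by rw [hkdef, div_le_one (by positivity)]; linarith
  set E := (1 + 2 / (c - 1)) * K / (2 * c) with hE
  refine ⟨(5 + 4 * K) * (k⁻¹) ^ 2 * Real.sqrt L * Real.exp E, by positivity, ?_⟩
  intro v V X m hv hV hVL hm
  have hV0 : 0 < V := lt_of_lt_of_le (by positivity) hV
  have h1 := weight_le (X := X) hv hK hm
  have h2 := sq_one_add_le_exp hk hk1 (y := (X - m) ^ 2 / v) (by positivity)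
  have h3 := exp_shift_le (X := X) hc hv hV hm
  have h4 := sqrt_inv_le hv hV0 hL hVL
  set y := (X - m) ^ 2 / v with hy
  have h5 : Real.exp (-(X - m) ^ 2 / (2 * v)) ≤
      Real.exp (-X ^ 2 / (2 * V)) * Real.exp E * Real.exp (-(2 * (k * y))) := by
    rw [← Real.exp_add, ← Real.exp_add]
    apply Real.exp_le_exp.2
    refine h3.trans (le_of_eq ?_)
    rw [hkdef, hE]; field_simp; ring
  have h6 : Real.exp (2 * (k * y)) * Real.exp (-(2 * (k * y))) = 1 := by
    rw [← Real.exp_add]; simp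
  calc (1 + X ^ 2 + X ^ 2 * |(X - m) / v|) * gauss v (X - m)
      ≤ ((5 + 4 * K) * (1 + v) * ((k⁻¹) ^ 2 * Real.exp (2 * (k * y)))) *
        ((Real.sqrt L * (Real.sqrt (2 * Real.pi * V))⁻¹) *
          (Real.exp (-X ^ 2 / (2 * V)) * Real.exp E * Real.exp (-(2 * (k * y))))) := by
        unfold gauss
        gcongr
        exact h1.trans (by gcongr)
    _ = (5 + 4 * K) * (k⁻¹) ^ 2 * Real.sqrt L * Real.exp E * (1 + v) *
        ((Real.sqrt (2 * Real.pi * V))⁻¹ * Real.exp (-X ^ 2 / (2 * V))) *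
          (Real.exp (2 * (k * y)) * Real.exp (-(2 * (k * y)))) := by ring
    _ = _ := by rw [h6, mul_one]; rfl

lemma one_add_nat_le_pow {c : ℝ} (hc : 1 < c) (n : ℕ) :
    1 + (n : ℝ) ≤ (1 + (c - 1)⁻¹) * c ^ n := by
  have hc0 : 0 < c - 1 := by linarith
  have h1 := one_add_mul_le_pow (a := c - 1) (by linarith) n
  rw [add_sub_cancel] at h1
  have h2 : (1 : ℝ) ≤ c ^ n := one_le_pow₀ hc.le
  have h3 : (n : ℝ) ≤ (c - 1)⁻¹ * c ^ n := by
    rw [inv_mul_eq_div, le_div_iff₀ hc0]; linarith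
  linarith

lemma GBn_eq (α θ : ℝ) (n : ℕ) (t x : ℝ) : GBn α θ n t x = gauss (α * t + n * θ) x := rfl

lemma Gn_eq (α θ l : ℝ) (n : ℕ) (t x : ℝ) :
    Gn α θ l n t x =
      gauss (α * t + n * θ) (x - (α / 2 + l * (Real.exp (θ / 2) - 1)) * t) := rfl

lemma le_variance {α θ s : ℝ} (hθ : 0 ≤ θ) (n : ℕ) : α * s ≤ α * s + n * θ := by
  have : 0 ≤ (n : ℝ) * θ := by positivity
  linarith

lemma summable_weighted_gauss {α θ s : ℝ} (hα : 0 < α) (hθ : 0 ≤ θ) (hs : 0 < s) (l : ℝ)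
    (hl : 0 ≤ l) (x : ℝ) :
    Summable fun n : ℕ => (l * s) ^ n / (Nat.factorial n : ℝ) * gauss (α * s + n * θ) x := by
  have hl' : 0 ≤ l * s := by positivity
  refine Summable.of_nonneg_of_le (fun n => mul_nonneg (by positivity) (gauss_nonneg _ _))
    (fun n => ?_)
    ((Real.summable_pow_div_factorial (l * s)).mul_right (Real.sqrt (2 * Real.pi * (α * s)))⁻¹)
  exact mul_le_mul_of_nonneg_left (gauss_le (by positivity) (le_variance hθ n) x) (by positivity)

lemma GB_nonneg {α θ l s : ℝ} (hl : 0 ≤ l) (hs : 0 ≤ s) (x : ℝ) : 0 ≤ GB α θ l s x := by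
  have hl' : 0 ≤ l * s := by positivity
  exact mul_nonneg (Real.exp_nonneg _)
    (tsum_nonneg fun n => mul_nonneg (by positivity) (gauss_nonneg _ _))

lemma G_nonneg {α θ l s : ℝ} (hl : 0 ≤ l) (hs : 0 ≤ s) (x : ℝ) : 0 ≤ G α θ l s x := by
  have hl' : 0 ≤ l * s := by positivity
  exact mul_nonneg (Real.exp_nonneg _)
    (tsum_nonneg fun n => mul_nonneg (by positivity) (gauss_nonneg _ _))

lemma GB_bounded_continuous {α θ l s : ℝ} (hα : 0 < α) (hθ : 0 ≤ θ) (hl : 0 ≤ l) (hs : 0 < s) :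
    Continuous (GB α θ l s) ∧ ∃ B, ∀ x, GB α θ l s x ≤ B := by
  have hl' : 0 ≤ l * s := by positivity
  have hsum := (Real.summable_pow_div_factorial (l * s)).mul_right
    (Real.sqrt (2 * Real.pi * (α * s)))⁻¹
  have hb : ∀ (n : ℕ) (x : ℝ), (l * s) ^ n / (Nat.factorial n : ℝ) * gauss (α * s + n * θ) x ≤
      (l * s) ^ n / (Nat.factorial n : ℝ) * (Real.sqrt (2 * Real.pi * (α * s)))⁻¹ := fun n x =>
    mul_le_mul_of_nonneg_left (gauss_le (by positivity) (le_variance hθ n) x) (by positivity)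
  constructor
  · refine continuous_const.mul (continuous_tsum (fun n => ?_) hsum fun n x => ?_)
    · exact continuous_const.mul (continuous_gauss _)
    · refine le_trans (le_of_eq ?_) (hb n x)
      exact Real.norm_of_nonneg (mul_nonneg (by positivity) (gauss_nonneg _ _))
  · refine ⟨Real.exp (-(l * s)) * ∑' n : ℕ, (l * s) ^ n / (Nat.factorial n : ℝ) *
      (Real.sqrt (2 * Real.pi * (α * s)))⁻¹, fun x => ?_⟩
    exact mul_le_mul_of_nonneg_left
      ((summable_weighted_gauss hα hθ hs l hl x).tsum_le_tsum (fun n => hb n x) hsum)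
      (Real.exp_nonneg _)

lemma abs_mul_gauss_le {v₀ v : ℝ} (h₀ : 0 < v₀) (h : v₀ ≤ v) (x : ℝ) :
    |-(x / v) * gauss v x| ≤ (1 + v₀⁻¹) * (Real.sqrt (2 * Real.pi * v₀))⁻¹ := by
  have hv : 0 < v := h₀.trans_le h
  have h1 : |x / v| * Real.exp (-x ^ 2 / (2 * v)) ≤ 1 + v₀⁻¹ := by
    have h2 : 1 + x ^ 2 / (2 * v) ≤ Real.exp (x ^ 2 / (2 * v)) := by
      linarith [Real.add_one_le_exp (x ^ 2 / (2 * v))]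
    rw [neg_div, Real.exp_neg, ← div_eq_mul_inv, div_le_iff₀ (Real.exp_pos _)]
    have h3 : |x / v| ≤ (1 + v⁻¹) * (1 + x ^ 2 / (2 * v)) := by
      rw [abs_div, abs_of_pos hv, div_le_iff₀ hv]
      have h4 : (1 + v⁻¹) * (1 + x ^ 2 / (2 * v)) * v =
          1 + v + x ^ 2 / 2 + x ^ 2 / (2 * v) := by
        field_simp; ring
      have h5 : 0 ≤ x ^ 2 / (2 * v) := by positivity
      rw [h4]
      nlinarith [sq_abs x, sq_nonneg (|x| - 1)]
    calc |x / v| ≤ (1 + v⁻¹) * (1 + x ^ 2 / (2 * v)) := h3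
      _ ≤ (1 + v₀⁻¹) * Real.exp (x ^ 2 / (2 * v)) := by gcongr
  have h6 : (Real.sqrt (2 * Real.pi * v))⁻¹ ≤ (Real.sqrt (2 * Real.pi * v₀))⁻¹ := by
    gcongr
  rw [abs_mul, abs_neg, abs_of_nonneg (gauss_nonneg _ _)]
  calc |x / v| * gauss v x
      = |x / v| * Real.exp (-x ^ 2 / (2 * v)) * (Real.sqrt (2 * Real.pi * v))⁻¹ := by
        unfold gauss; ring
    _ ≤ _ := by gcongr

lemma hasDerivAt_tsum_gauss {α θ l s : ℝ} (hα : 0 < α) (hθ : 0 ≤ θ) (hl : 0 ≤ l) (hs : 0 < s)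
    (m x : ℝ) :
    HasDerivAt
      (fun x => ∑' n : ℕ, (l * s) ^ n / (Nat.factorial n : ℝ) * gauss (α * s + n * θ) (x - m))
      (∑' n : ℕ, (l * s) ^ n / (Nat.factorial n : ℝ) *
        (-((x - m) / (α * s + n * θ)) * gauss (α * s + n * θ) (x - m))) x := by
  have hl' : 0 ≤ l * s := by positivity
  have hsum := (Real.summable_pow_div_factorial (l * s)).mul_right
    ((1 + (α * s)⁻¹) * (Real.sqrt (2 * Real.pi * (α * s)))⁻¹)
  have hd : ∀ (n : ℕ) (y : ℝ), HasDerivAt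
      (fun y => (l * s) ^ n / (Nat.factorial n : ℝ) * gauss (α * s + n * θ) (y - m))
      ((l * s) ^ n / (Nat.factorial n : ℝ) *
        (-((y - m) / (α * s + n * θ)) * gauss (α * s + n * θ) (y - m))) y := fun n y =>
    ((hasDerivAt_gauss (lt_of_lt_of_le (mul_pos hα hs) (le_variance hθ n))
      (y - m)).comp_sub_const y m).const_mul _
  refine hasDerivAt_tsum hsum hd (fun n y => ?_)
    (summable_weighted_gauss hα hθ hs l hl (x - m)) x
  rw [norm_mul, Real.norm_of_nonneg (by positivity), Real.norm_eq_abs]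
  exact mul_le_mul_of_nonneg_left
    (abs_mul_gauss_le (mul_pos hα hs) (le_variance hθ n) _) (by positivity)

lemma hasDerivAt_G {α θ l s : ℝ} (hα : 0 < α) (hθ : 0 ≤ θ) (hl : 0 ≤ l) (hs : 0 < s) (x : ℝ) :
    HasDerivAt (G α θ l s)
      (Real.exp (-(l * s)) * ∑' n : ℕ, (l * s) ^ n / (Nat.factorial n : ℝ) *
        (-((x - (α / 2 + l * (Real.exp (θ / 2) - 1)) * s) / (α * s + n * θ)) *
          Gn α θ l n s x)) x :=
  (hasDerivAt_tsum_gauss hα hθ hl hs ((α / 2 + l * (Real.exp (θ / 2) - 1)) * s) x).const_mul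
    (Real.exp (-(l * s)))

lemma weight_pow_le {A M c l s τ D : ℝ} {n : ℕ} (hA : A = c * M) (hM : 0 < M) (hc : 1 < c)
    (hs : 0 < s) (hsτ : s ≤ τ) (hl : 0 ≤ l) (hlM : l ≤ M) (hD : 0 ≤ D) :
    Real.exp (-(l * s)) * ((l * s) ^ n / (Nat.factorial n : ℝ)) * (D * (1 + n)) ≤
      D * (1 + (c - 1)⁻¹) * Real.exp (A * τ) *
        (Real.exp (-(A * s)) * ((A * s) ^ n / (Nat.factorial n : ℝ))) := by
  have hc0 : 0 < c - 1 := by linarith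
  have hc1 : 0 < c := by linarith
  have hls : 0 ≤ l * s := by positivity
  have h1 : Real.exp (-(l * s)) ≤ 1 := by rw [Real.exp_le_one_iff]; linarith
  have h2 : 1 ≤ Real.exp (A * τ) * Real.exp (-(A * s)) := by
    rw [← Real.exp_add, Real.one_le_exp_iff]
    have : A * s ≤ A * τ := by rw [hA]; gcongr
    linarith
  have h3 := one_add_nat_le_pow hc n
  calc Real.exp (-(l * s)) * ((l * s) ^ n / (Nat.factorial n : ℝ)) * (D * (1 + n))
      ≤ 1 * ((M * s) ^ n / (Nat.factorial n : ℝ)) * (D * ((1 + (c - 1)⁻¹) * c ^ n)) := by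
        gcongr
    _ = 1 * (D * (1 + (c - 1)⁻¹) * ((A * s) ^ n / (Nat.factorial n : ℝ))) := by
        rw [hA, mul_assoc c M s, mul_pow c]; ring
    _ ≤ (Real.exp (A * τ) * Real.exp (-(A * s))) *
        (D * (1 + (c - 1)⁻¹) * ((A * s) ^ n / (Nat.factorial n : ℝ))) := by
        have : 0 ≤ A := by rw [hA]; positivity
        gcongr
    _ = _ := by ring

/-- Termwise domination of `Γ` and its derivative, with quadratic weights, by `Γ̄`. -/
lemma term_le {M c τ : ℝ} (hM : 1 ≤ M) (hc : 1 < c) (hτ : 0 < τ) :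
    ∃ C : ℝ, 0 ≤ C ∧ ∀ α θ l s X : ℝ, M⁻¹ ≤ α → α ≤ M → M⁻¹ ≤ θ → θ ≤ M → 0 ≤ l → l ≤ M →
      0 < s → s ≤ τ → ∀ n : ℕ,
      Real.exp (-(l * s)) * ((l * s) ^ n / (Nat.factorial n : ℝ)) *
        ((1 + X ^ 2 + X ^ 2 * |(X - (α / 2 + l * (Real.exp (θ / 2) - 1)) * s) /
          (α * s + n * θ)|) * Gn α θ l n s X) ≤
      C * (Real.exp (-(c * M * s)) * ((c * M * s) ^ n / (Nat.factorial n : ℝ)) *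
        GBn (c * M) (c * M) n s X) := by
  have hM0 : 0 < M := by linarith
  have hc1 : 0 < c := by linarith
  have hc0 : 0 < c - 1 := by linarith
  set B := M / 2 + M * Real.exp (M / 2) with hB
  have hB0 : 0 ≤ B := by positivity
  obtain ⟨D, hD, h⟩ := weighted_gauss_le hc (K := B ^ 2 * (M * τ)) (L := c * M ^ 2)
    (by positivity) (by positivity)
  refine ⟨D * (1 + M * (τ + 1)) * (1 + (c - 1)⁻¹) * Real.exp (c * M * τ), by positivity, ?_⟩
  intro α θ l s X hα hαM hθ hθM hl hlM hs hsτ n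
  have hα0 : 0 < α := lt_of_lt_of_le (by positivity) hα
  have hθ0 : 0 < θ := lt_of_lt_of_le (by positivity) hθ
  have hls : 0 ≤ l * s := by positivity
  set v := α * s + n * θ with hv
  have hv0 : 0 < v := by positivity
  have hvM : v ≤ M * (s + n) := by
    have h1 : α * s ≤ M * s := by gcongr
    have h2 : n * θ ≤ n * M := by gcongr
    linarith
  have hαM1 : 1 ≤ M * α := by rwa [inv_le_iff_one_le_mul₀' hM0] at hα
  have hθM1 : 1 ≤ M * θ := by rwa [inv_le_iff_one_le_mul₀' hM0] at hθ
  have hMv : s + n ≤ M * v := by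
    have h1 : 1 * s ≤ M * α * s := by gcongr
    have h2 : 1 * (n : ℝ) ≤ M * θ * n := by gcongr
    rw [hv]; linarith
  have hb0 : 0 ≤ α / 2 + l * (Real.exp (θ / 2) - 1) := by
    have : 1 ≤ Real.exp (θ / 2) := Real.one_le_exp (by positivity)
    have : 0 ≤ l * (Real.exp (θ / 2) - 1) := mul_nonneg hl (by linarith)
    positivity
  have hbB : α / 2 + l * (Real.exp (θ / 2) - 1) ≤ B := by
    have h1 : l * (Real.exp (θ / 2) - 1) ≤ l * Real.exp (θ / 2) := by gcongr; linarith
    have h2 : l * Real.exp (θ / 2) ≤ M * Real.exp (M / 2) := by gcongr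
    rw [hB]; linarith
  set m := (α / 2 + l * (Real.exp (θ / 2) - 1)) * s with hm
  have hm2 : m ^ 2 ≤ B ^ 2 * (M * τ) * v := by
    have hs2 : s ≤ M * v := by linarith [(Nat.cast_nonneg n : (0 : ℝ) ≤ n)]
    calc m ^ 2 ≤ (B * s) ^ 2 := by rw [hm]; gcongr
      _ = B ^ 2 * (s * s) := by ring
      _ ≤ B ^ 2 * (τ * (M * v)) := by gcongr
      _ = _ := by ring
  have key := h v (c * M * s + n * (c * M)) X m hv0
    (by nlinarith) (by nlinarith [mul_le_mul_of_nonneg_left hMv (by positivity : 0 ≤ c * M)]) hm2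
  have hv1 : 1 + v ≤ (1 + M * (τ + 1)) * (1 + n) := by
    have hn : (0 : ℝ) ≤ n := Nat.cast_nonneg n
    have h1 : M * (s + n) ≤ M * ((τ + 1) * (1 + n)) := by
      gcongr; nlinarith
    nlinarith
  have hw := weight_pow_le (A := c * M) (n := n) rfl hM0 hc hs hsτ hl hlM
    (mul_nonneg hD (by positivity : 0 ≤ 1 + M * (τ + 1)))
  calc _ ≤ Real.exp (-(l * s)) * ((l * s) ^ n / (Nat.factorial n : ℝ)) *
        (D * (1 + M * (τ + 1)) * (1 + n) * GBn (c * M) (c * M) n s X) := by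
        rw [Gn_eq, GBn_eq]
        refine mul_le_mul_of_nonneg_left (key.trans ?_) (by positivity)
        refine mul_le_mul_of_nonneg_right ?_ (gauss_nonneg _ _)
        rw [mul_assoc]
        exact mul_le_mul_of_nonneg_left hv1 hD
    _ = Real.exp (-(l * s)) * ((l * s) ^ n / (Nat.factorial n : ℝ)) *
        (D * (1 + M * (τ + 1)) * (1 + n)) * GBn (c * M) (c * M) n s X := by ring
    _ ≤ _ := by
        rw [← mul_assoc (D * (1 + M * (τ + 1)) * (1 + (c - 1)⁻¹) * Real.exp (c * M * τ))]
        exact mul_le_mul_of_nonneg_right hw (gauss_nonneg _ _)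

/-- Domination of `Γ` and its derivative, with quadratic weights, by `Γ̄`. -/
lemma G_le_GB {M c τ : ℝ} (hM : 1 ≤ M) (hc : 1 < c) (hτ : 0 < τ) :
    ∃ C : ℝ, 0 ≤ C ∧ ∀ α θ l s X : ℝ, M⁻¹ ≤ α → α ≤ M → M⁻¹ ≤ θ → θ ≤ M → 0 ≤ l → l ≤ M →
      0 < s → s ≤ τ →
      (1 + X ^ 2) * G α θ l s X ≤ C * GB (c * M) (c * M) (c * M) s X ∧
      X ^ 2 * |deriv (G α θ l s) X| ≤ C * GB (c * M) (c * M) (c * M) s X := by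
  obtain ⟨C, hC, h⟩ := term_le hM hc hτ
  refine ⟨C, hC, ?_⟩
  intro α θ l s X hα hαM hθ hθM hl hlM hs hsτ
  have h := h α θ l s X hα hαM hθ hθM hl hlM hs hsτ
  have hM0 : 0 < M := by linarith
  have hc1 : 0 < c := by linarith
  have hα0 : 0 < α := lt_of_lt_of_le (by positivity) hα
  have hθ0 : 0 < θ := lt_of_lt_of_le (by positivity) hθ
  have hls : 0 ≤ l * s := by positivity
  have hsumGB := summable_weighted_gauss (α := c * M) (θ := c * M) (l := c * M) (s := s)
    (by positivity) (by positivity) hs (by positivity) X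
  have hR : HasSum (fun n : ℕ => C * (Real.exp (-(c * M * s)) *
      ((c * M * s) ^ n / (Nat.factorial n : ℝ)) * GBn (c * M) (c * M) n s X))
      (C * GB (c * M) (c * M) (c * M) s X) := by
    simpa only [mul_assoc, GB, GBn_eq] using (hsumGB.hasSum.mul_left (Real.exp (-(c * M * s)))).mul_left C
  have hGn : ∀ n, 0 ≤ Gn α θ l n s X := fun n => gauss_nonneg _ _
  constructor
  · have hL := ((summable_weighted_gauss hα0 hθ0.le hs l hl
      (X - (α / 2 + l * (Real.exp (θ / 2) - 1)) * s)).hasSum.mul_left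
        (Real.exp (-(l * s)))).mul_left (1 + X ^ 2)
    refine hasSum_le (fun n => ?_) hL hR
    refine le_trans (le_of_eq ?_) ((mul_le_mul_of_nonneg_left (mul_le_mul_of_nonneg_right
      (le_add_of_nonneg_right (by positivity)) (hGn n)) (by positivity)).trans (h n))
    · rw [Gn_eq]; ring
  · rw [(hasDerivAt_G hα0 hθ0.le hl hs X).deriv]
    rw [← tsum_mul_left, ← abs_of_nonneg (sq_nonneg X), ← abs_mul, ← tsum_mul_left,
      ← hR.tsum_eq, ← Real.norm_eq_abs]
    refine tsum_of_norm_bounded hR.summable.hasSum fun n => ?_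
    refine le_trans (le_of_eq ?_) ((mul_le_mul_of_nonneg_left (mul_le_mul_of_nonneg_right
      (le_add_of_nonneg_left (by positivity : (0 : ℝ) ≤ 1 + X ^ 2)) (hGn n))
        (by positivity)).trans (h n))
    rw [Real.norm_eq_abs, abs_mul, abs_mul, abs_mul, abs_mul, abs_neg,
      abs_of_nonneg (hGn n), abs_of_nonneg (sq_nonneg X), abs_of_pos (Real.exp_pos _),
      abs_of_nonneg (by positivity : 0 ≤ (l * s) ^ n / (Nat.factorial n : ℝ))]
    ring

lemma integrable_gauss {v : ℝ} (hv : 0 < v) : Integrable (gauss v) := by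
  have h := (integrable_exp_neg_mul_sq (b := (2 * v)⁻¹) (by positivity)).const_mul
    (Real.sqrt (2 * Real.pi * v))⁻¹
  refine h.congr (Filter.Eventually.of_forall fun x => ?_)
  simp only [gauss]
  congr 2
  ring

lemma conv_eq (θ : ℝ) (f : ℝ → ℝ) (x : ℝ) : conv θ f x = ∫ z : ℝ, f (x + z) * gauss θ z := rfl

lemma sq_mul_conv_le {f g : ℝ → ℝ} {θ A C D X : ℝ} (hf : ∀ x, 0 ≤ f x)
    (hg : Continuous g) (hg0 : ∀ x, 0 ≤ g x) (hgB : ∃ B, ∀ x, g x ≤ B) (hA : 0 < A) (hC : 0 ≤ C)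
    (hfg : ∀ x, (1 + x ^ 2) * f x ≤ C * g x)
    (hθ : ∀ z, (1 + z ^ 2) * gauss θ z ≤ D * gauss A z) :
    X ^ 2 * conv θ f X ≤ 2 * C * D * conv A g X := by
  obtain ⟨B, hB⟩ := hgB
  rw [conv_eq, conv_eq, ← integral_const_mul, ← integral_const_mul]
  refine integral_mono_of_nonneg (Filter.Eventually.of_forall fun z => ?_) ?_
    (Filter.Eventually.of_forall fun z => ?_)
  · exact mul_nonneg (sq_nonneg X) (mul_nonneg (hf _) (gauss_nonneg _ _))
  · refine ((integrable_gauss hA).bdd_mul (c := B) ?_ ?_).const_mul _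
    · exact (hg.comp (continuous_const.add continuous_id)).aestronglyMeasurable
    · refine Filter.Eventually.of_forall fun z => ?_
      rw [Real.norm_of_nonneg (hg0 _)]
      exact hB _
  · have h1 : X ^ 2 ≤ 2 * ((1 + (X + z) ^ 2) * (1 + z ^ 2)) := by
      nlinarith [sq_nonneg (X + z + z), mul_nonneg (sq_nonneg (X + z)) (sq_nonneg z)]
    have hfz := hf (X + z)
    have hgz := gauss_nonneg θ z
    calc X ^ 2 * (f (X + z) * gauss θ z)
        ≤ 2 * ((1 + (X + z) ^ 2) * (1 + z ^ 2)) * (f (X + z) * gauss θ z) := by gcongr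
      _ = 2 * (((1 + (X + z) ^ 2) * f (X + z)) * ((1 + z ^ 2) * gauss θ z)) := by ring
      _ ≤ 2 * ((C * g (X + z)) * (D * gauss A z)) := by
          have := hg0 (X + z)
          exact mul_le_mul_of_nonneg_left (mul_le_mul (hfg _) (hθ z) (by positivity)
            (by positivity)) zero_le_two
      _ = _ := by ring

/-- Proposition 5.4 (case `n = 0`): bound for the jump part of the operator applied to `p⁰`. -/
theorem stmt16 (M c τ : ℝ) (hM : 1 ≤ M) (hc : 1 < c) (hτ : 0 < τ) :
    ∃ C : ℝ, 0 < C ∧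
      ∀ (δ : ℝ) (a lam : ℝ → ℝ),
        0 < δ → M⁻¹ ≤ δ ^ 2 → δ ^ 2 ≤ M →
        (∀ w : ℝ, M⁻¹ ≤ a w) → (∀ w : ℝ, a w ≤ M) →
        (∀ w : ℝ, 0 ≤ lam w) → (∀ w : ℝ, lam w ≤ M) →
        ∀ x y t T : ℝ, t < T → T - t ≤ τ →
          |(x - y) ^ 2 *
              ((Real.exp (δ ^ 2 / 2) - 1) * deriv (fun w => p0 a lam δ t w T y) x
                + conv (δ ^ 2) (fun w => p0 a lam δ t w T y) x
                - p0 a lam δ t x T y)| ≤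
            C * (GB (c * M) (c * M) (c * M) (T - t) (x - y)
              + conv (c * M) (GB (c * M) (c * M) (c * M) (T - t)) (x - y)) := by
  have hM0 : 0 < M := by linarith
  have hc1 : 0 < c := by linarith
  have hA : 0 < c * M := by positivity
  obtain ⟨C, hC, hG⟩ := G_le_GB hM hc hτ
  obtain ⟨D, hD, hgauss⟩ := weighted_gauss_le hc (K := 0) (L := c * M ^ 2) le_rfl (by positivity)
  refine ⟨C * (Real.exp (M / 2) + 1) + 2 * C * (D * (1 + M)) + 1, by positivity, ?_⟩
  intro δ a lam hδ hδ1 hδ2 ha1 ha2 hl1 hl2 x y t T htT hTt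
  set s := T - t with hs
  have hs0 : 0 < s := by linarith
  set X := x - y with hX
  set α := a y
  set l := lam y
  set θ := δ ^ 2
  have hα0 : 0 < α := lt_of_lt_of_le (by positivity) (ha1 y)
  have hθ0 : 0 < θ := by positivity
  have hθ : ∀ z, (1 + z ^ 2) * gauss θ z ≤ D * (1 + M) * gauss (c * M) z := by
    intro z
    have hθM1 : 1 ≤ M * θ := by rwa [inv_le_iff_one_le_mul₀' hM0] at hδ1
    have h1 := hgauss θ (c * M) z 0 hθ0 (by gcongr)
      (by nlinarith [mul_le_mul_of_nonneg_left hθM1 hA.le]) (by simp)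
    rw [sub_zero] at h1
    have h0 := gauss_nonneg θ z
    have h2 := gauss_nonneg (c * M) z
    calc (1 + z ^ 2) * gauss θ z ≤ (1 + z ^ 2 + z ^ 2 * |z / θ|) * gauss θ z := by
          exact mul_le_mul_of_nonneg_right (le_add_of_nonneg_right (by positivity)) h0
      _ ≤ D * (1 + θ) * gauss (c * M) z := h1
      _ ≤ _ := by gcongr
  have hGs := fun X => hG α θ l s X (ha1 y) (ha2 y) hδ1 hδ2 (hl1 y) (hl2 y) hs0 hTt
  obtain ⟨hcont, hbdd⟩ := GB_bounded_continuous (α := c * M) (θ := c * M) (l := c * M) (s := s)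
    hA hA.le hA.le hs0
  have hGB0 : ∀ x, 0 ≤ GB (c * M) (c * M) (c * M) s x := GB_nonneg hA.le hs0.le
  have hGnn : ∀ x, 0 ≤ G α θ l s x := G_nonneg (hl1 y) hs0.le
  have hconv : X ^ 2 * conv θ (G α θ l s) X ≤ 2 * C * (D * (1 + M)) *
      conv (c * M) (GB (c * M) (c * M) (c * M) s) X :=
    sq_mul_conv_le hGnn hcont hGB0 hbdd hA hC (fun x => (hGs x).1) hθ
  have hconv0 : 0 ≤ conv θ (G α θ l s) X :=
    integral_nonneg fun z => mul_nonneg (hGnn _) (gauss_nonneg _ _)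
  have hconvB0 : 0 ≤ conv (c * M) (GB (c * M) (c * M) (c * M) s) X :=
    integral_nonneg fun z => mul_nonneg (hGB0 _) (gauss_nonneg _ _)
  have hderiv : deriv (fun w => p0 a lam δ t w T y) x = deriv (G α θ l s) X :=
    deriv_comp_sub_const (G α θ l s) y x
  have hconvp : conv θ (fun w => p0 a lam δ t w T y) x = conv θ (G α θ l s) X := by
    unfold conv
    congr 1
    ext z
    simp only [p0, hX, add_sub_right_comm]
    rfl
  rw [hderiv, hconvp, show p0 a lam δ t x T y = G α θ l s X from rfl]
  obtain ⟨h1, h2⟩ := hGs X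
  have hG0 := hGnn X
  have hGB := hGB0 X
  have he0 : 0 ≤ Real.exp (θ / 2) - 1 := by
    have : 1 ≤ Real.exp (θ / 2) := Real.one_le_exp (by positivity)
    linarith
  have he1 : Real.exp (θ / 2) - 1 ≤ Real.exp (M / 2) := by
    have : Real.exp (θ / 2) ≤ Real.exp (M / 2) := by gcongr
    linarith
  set g := GB (c * M) (c * M) (c * M) s X
  set k := conv (c * M) (GB (c * M) (c * M) (c * M) s) X
  have hd : (Real.exp (θ / 2) - 1) * (X ^ 2 * |deriv (G α θ l s) X|) ≤
      Real.exp (M / 2) * (C * g) := by gcongr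
  calc |X ^ 2 * ((Real.exp (θ / 2) - 1) * deriv (G α θ l s) X + conv θ (G α θ l s) X
        - G α θ l s X)|
      = |(Real.exp (θ / 2) - 1) * (X ^ 2 * deriv (G α θ l s) X) +
          X ^ 2 * conv θ (G α θ l s) X - X ^ 2 * G α θ l s X| := by congr 1; ring
    _ ≤ |(Real.exp (θ / 2) - 1) * (X ^ 2 * deriv (G α θ l s) X)| +
          |X ^ 2 * conv θ (G α θ l s) X| + |X ^ 2 * G α θ l s X| :=
        (abs_sub _ _).trans (by gcongr; exact abs_add_le _ _)
    _ = (Real.exp (θ / 2) - 1) * (X ^ 2 * |deriv (G α θ l s) X|) +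
          X ^ 2 * conv θ (G α θ l s) X + X ^ 2 * G α θ l s X := by
        rw [abs_mul, abs_mul (X ^ 2), abs_of_nonneg he0, abs_of_nonneg (sq_nonneg X),
          abs_of_nonneg (by positivity : 0 ≤ X ^ 2 * conv θ (G α θ l s) X),
          abs_of_nonneg (by positivity : 0 ≤ X ^ 2 * G α θ l s X)]
    _ ≤ Real.exp (M / 2) * (C * g) + 2 * C * (D * (1 + M)) * k + C * g := by
        have h3 : X ^ 2 * G α θ l s X ≤ C * g := by linarith
        exact add_le_add (add_le_add hd hconv) h3
    _ = C * (Real.exp (M / 2) + 1) * g + 2 * C * (D * (1 + M)) * k := by ring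
    _ ≤ (C * (Real.exp (M / 2) + 1) + 2 * C * (D * (1 + M)) + 1) * g +
          (C * (Real.exp (M / 2) + 1) + 2 * C * (D * (1 + M)) + 1) * k := by
        have e1 : 0 ≤ C * (Real.exp (M / 2) + 1) := by positivity
        have e2 : 0 ≤ 2 * C * (D * (1 + M)) := by positivity
        gcongr <;> linarith
    _ = _ := by ring
end

section
/- (Poisson-index comparison estimate.) For every M ≥ 1, T > 0 and integer η ≥ 1 there exists a constant C₀ > 0, depending only on M, T and η, such that for all admissible parameters (α, θ, ℓ), every t ∈ (0, T] and every x ∈ ℝ, one has Γ_{n+η}^{α,θ,ℓ}(t,x) ≤ C₀ · Γ_n^{α, 2(η+1)θ, ℓ}(t,x) for every integer n ≥ 1, and moreover Γ_η^{α,θ,ℓ}(t,x) ≤ C₀ · Γ_1^{α, 2(η+1)θ, ℓ}(t,x). -/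
open Real MeasureTheory

/-- Two-term Titu (Sedrakyan) inequality. -/
theorem add_sq_div_add_le {A E : ℝ} (hA : 0 < A) (hE : 0 < E) (y d : ℝ) :
    (y + d) ^ 2 / (A + E) ≤ y ^ 2 / A + d ^ 2 / E := by
  rw [div_add_div _ _ hA.ne' hE.ne', div_le_div_iff₀ (by positivity) (by positivity)]
  nlinarith [sq_nonneg (y * E - d * A)]

/-- A Gaussian density is dominated by one of larger, comparable variance and shifted mean. -/
theorem gaussian_le_mul_gaussian {A B K δ D m m' : ℝ} (hA : 0 < A) (hδ : 0 < δ)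
    (hAB : A + δ ≤ B) (hK : 0 ≤ K) (hBA : B ≤ K * A) (hD : |m - m'| ≤ D) (x : ℝ) :
    (√(2 * π * A))⁻¹ * exp (-(x - m) ^ 2 / (2 * A)) ≤
      (√K * exp (D ^ 2 / (2 * δ))) * ((√(2 * π * B))⁻¹ * exp (-(x - m') ^ 2 / (2 * B))) := by
  have hB : 0 < B := by linarith
  have hsqrt : (√(2 * π * A))⁻¹ ≤ √K * (√(2 * π * B))⁻¹ := by
    rw [← div_eq_mul_inv, inv_eq_one_div, div_le_div_iff₀ (by positivity) (by positivity),
      one_mul, ← Real.sqrt_mul hK]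
    apply Real.sqrt_le_sqrt
    nlinarith [mul_le_mul_of_nonneg_left hBA (by positivity : 0 ≤ 2 * π)]
  have hexp : exp (-(x - m) ^ 2 / (2 * A)) ≤
      exp (D ^ 2 / (2 * δ)) * exp (-(x - m') ^ 2 / (2 * B)) := by
    rw [← Real.exp_add, Real.exp_le_exp]
    have hsplit := add_sq_div_add_le hA (sub_pos.2 (show A < B by linarith)) (x - m) (m - m')
    rw [sub_add_sub_cancel, add_sub_cancel] at hsplit
    have hd : (m - m') ^ 2 / (B - A) ≤ D ^ 2 / δ :=
      div_le_div₀ (sq_nonneg D) (sq_le_sq.2 (hD.trans (le_abs_self D))) hδ (by linarith)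
    have half (u v : ℝ) : u / (2 * v) = u / v / 2 := by rw [mul_comm, div_div]
    simp only [half, neg_div]
    linarith
  calc _ ≤ (√K * (√(2 * π * B))⁻¹) *
        (exp (D ^ 2 / (2 * δ)) * exp (-(x - m') ^ 2 / (2 * B))) := by gcongr
    _ = _ := by ring

/-- The means of two jump-diffusion components with jump variances at most `R` differ by
at most `M * exp (R / 2) * T`. -/
theorem abs_drift_sub_drift_le {M T R α θ θ' l t : ℝ} (hθR : θ ≤ R)
    (hθR' : θ' ≤ R) (hl : 0 ≤ l) (hlM : l ≤ M) (ht : 0 ≤ t) (htT : t ≤ T) :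
    |(α / 2 + l * (exp (θ / 2) - 1)) * t - (α / 2 + l * (exp (θ' / 2) - 1)) * t| ≤
      M * exp (R / 2) * T := by
  have hdiff : |exp (θ / 2) - exp (θ' / 2)| ≤ exp (R / 2) := by
    have h₁ : exp (θ / 2) ≤ exp (R / 2) := by gcongr
    have h₂ : exp (θ' / 2) ≤ exp (R / 2) := by gcongr
    rw [abs_le]
    constructor <;> linarith [exp_pos (θ / 2), exp_pos (θ' / 2)]
  have hM : 0 ≤ M := hl.trans hlM
  calc _ = |l * (exp (θ / 2) - exp (θ' / 2)) * t| := by ring_nf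
    _ = l * |exp (θ / 2) - exp (θ' / 2)| * t := by
      rw [abs_mul, abs_mul, abs_of_nonneg hl, abs_of_nonneg ht]
    _ ≤ M * exp (R / 2) * T := by gcongr

/-- Poisson-index comparison estimate: `Γ_{n+η}^{α,θ,ℓ}(t,x) ≤ C₀ Γ_n^{α,2(η+1)θ,ℓ}(t,x)`
for `n ≥ 1`, and `Γ_η^{α,θ,ℓ}(t,x) ≤ C₀ Γ_1^{α,2(η+1)θ,ℓ}(t,x)`. -/
theorem stmt18 (M T : ℝ) (η : ℕ) (hM : 1 ≤ M) (hT : 0 < T) (hη : 1 ≤ η) :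
    ∃ C₀ : ℝ, 0 < C₀ ∧
      ∀ α θ l : ℝ, M⁻¹ ≤ α → α ≤ M → M⁻¹ ≤ θ → θ ≤ M → 0 ≤ l → l ≤ M →
        ∀ t ∈ Set.Ioc (0 : ℝ) T, ∀ x : ℝ,
          (∀ n : ℕ, 1 ≤ n →
            Gn α θ l (n + η) t x ≤ C₀ * Gn α (2 * ((η : ℝ) + 1) * θ) l n t x) ∧
          Gn α θ l η t x ≤ C₀ * Gn α (2 * ((η : ℝ) + 1) * θ) l 1 t x := by
  have hM₀ : 0 < M := by linarith
  have hη₁ : (1 : ℝ) ≤ η := by exact_mod_cast hη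
  set K : ℝ := 2 * ((η : ℝ) + 1) with hK
  refine ⟨√K * exp ((M * exp (K * M / 2) * T) ^ 2 / (2 * M⁻¹)), by positivity, ?_⟩
  intro α θ l hα _ hθ hθM hl hlM t ht x
  have hδ : 0 < M⁻¹ := inv_pos.2 hM₀
  have hθ₀ : 0 < θ := hδ.trans_le hθ
  have hαt : 0 < α * t := mul_pos (hδ.trans_le hα) ht.1
  have hKθ : K * θ ≤ K * M := by gcongr
  have hθK : θ ≤ K * θ := by nlinarith
  have hD := abs_drift_sub_drift_le (α := α) (hθK.trans hKθ)
    hKθ hl hlM ht.1.le ht.2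
  have compare (k n : ℕ) (h₁ : (k : ℝ) + 1 ≤ K * n) (h₂ : n ≤ k) :
      Gn α θ l k t x ≤
        √K * exp ((M * exp (K * M / 2) * T) ^ 2 / (2 * M⁻¹)) * Gn α (K * θ) l n t x := by
    have h₂' : (n : ℝ) ≤ k := by exact_mod_cast h₂
    refine gaussian_le_mul_gaussian (by positivity) hδ ?_ (by positivity) ?_ hD x
    · nlinarith [mul_le_mul_of_nonneg_right h₁ hθ₀.le]
    · have : n * θ ≤ k * θ := by gcongr
      nlinarith [mul_le_mul_of_nonneg_left this (by positivity : 0 ≤ K)]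
  refine ⟨fun n hn => compare (n + η) n ?_ (Nat.le_add_right n η), compare η 1 ?_ hη⟩
  · have hn₁ : (1 : ℝ) ≤ n := by exact_mod_cast hn
    push_cast
    nlinarith
  · push_cast
    linarith
end
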